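/- For every nonnegative f ∈ L¹(ℝ³): (∫_{ℝ³} f dq)² − Σ_{i=1}^{3} (∫_{ℝ³} f q_i/q₀ dq)² ≥ (∫_{ℝ³} f dq)(∫_{ℝ³} f q₀^{−2} dq) ≥ (∫_{ℝ³} f q₀^{−2} dq)². In particular, the proper particle density satisfies n_f ≥ ∫_{ℝ³} f q₀^{−2} dq. -/

import Mathlib

open MeasureTheory Real Set

noncomputable section

abbrev E3 := EuclideanSpace ℝ (Fin 3)

/-- `q₀ = √(1+|q|²)` -/
def q0 (q : E3) : ℝ := Real.sqrt (1 + ‖q‖ ^ 2)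

/-- proper particle density `n_f` (nonnegative, with `n_f² = (∫f)² - Σᵢ (∫ f qᵢ/q₀)²`) -/
def nDens (f : E3 → ℝ) : ℝ :=
  Real.sqrt ((∫ q, f q) ^ 2 - ∑ i : Fin 3, (∫ q, f q * (q i / q0 q)) ^ 2)

/-- velocity `u_f = (1/n_f) ∫ f q/q₀` -/
def uVel (f : E3 → ℝ) : E3 :=
  (nDens f)⁻¹ • ∫ q, f q • ((q0 q)⁻¹ • q)

/-- `α_f = (1/n_f) ∫ f/q₀` -/
def alphaF (f : E3 → ℝ) : ℝ := (nDens f)⁻¹ * ∫ q, f q / q0 q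

theorem integrable_mul_sq {α : Type*} [MeasurableSpace α] {μ : Measure α} {f v : α → ℝ}
    (hf : Integrable f μ) (hv : AEStronglyMeasurable v μ) (hv1 : ∀ x, |v x| ≤ 1) :
    Integrable (fun x => f x * v x ^ 2) μ := by
  refine hf.mul_bdd (c := 1) (hv.pow 2) (Filter.Eventually.of_forall fun x => ?_)
  simpa using (sq_le_one_iff_abs_le_one (v x)).2 (hv1 x)

/-- Cauchy–Schwarz for a nonnegative integrable weight and a function bounded by one. -/
theorem sq_integral_mul_le {α : Type*} [MeasurableSpace α] {μ : Measure α} {f v : α → ℝ}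
    (hf : Integrable f μ) (hf0 : ∀ x, 0 ≤ f x) (hv : AEStronglyMeasurable v μ)
    (hv1 : ∀ x, |v x| ≤ 1) :
    (∫ x, f x * v x ∂μ) ^ 2 ≤ (∫ x, f x ∂μ) * ∫ x, f x * v x ^ 2 ∂μ := by
  have hfv : Integrable (fun x => f x * v x) μ :=
    hf.mul_bdd (c := 1) hv (Filter.Eventually.of_forall hv1)
  have hfv2 := integrable_mul_sq hf hv hv1
  have key : ∀ t : ℝ, 0 ≤ (∫ x, f x ∂μ) * (t * t) + (-2 * ∫ x, f x * v x ∂μ) * t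
      + ∫ x, f x * v x ^ 2 ∂μ := by
    intro t
    have h : 0 ≤ ∫ x, (f x * (t * t) + f x * v x * (-2 * t) + f x * v x ^ 2) ∂μ := by
      refine integral_nonneg fun x => ?_
      have := mul_nonneg (hf0 x) (sq_nonneg (v x - t))
      simp only [Pi.zero_apply]
      linarith
    have hsum : Integrable (fun x => f x * (t * t) + f x * v x * (-2 * t)) μ :=
      (hf.mul_const _).add (hfv.mul_const _)
    rw [integral_add hsum hfv2, integral_add (hf.mul_const _) (hfv.mul_const _),
      integral_mul_const, integral_mul_const] at h
    linarith
  have := discrim_le_zero key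
  rw [discrim] at this
  linarith

theorem q0_sq (q : E3) : q0 q ^ 2 = 1 + ‖q‖ ^ 2 :=
  Real.sq_sqrt (by positivity)

theorem q0_pos (q : E3) : 0 < q0 q :=
  Real.sqrt_pos.2 (by positivity)

theorem continuous_q0 : Continuous q0 := by
  unfold q0
  fun_prop

theorem abs_div_q0_le_one (q : E3) (i : Fin 3) : |q i / q0 q| ≤ 1 := by
  rw [abs_div, abs_of_pos (q0_pos q), div_le_one (q0_pos q)]
  have h : |q i| ≤ ‖q‖ := PiLp.norm_apply_le q i
  exact h.trans (Real.le_sqrt_of_sq_le (by linarith))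

/-- The mass shell relation `|q|² / q₀² = 1 - 1 / q₀²`. -/
theorem sum_sq_div_q0 (q : E3) : ∑ i : Fin 3, (q i / q0 q) ^ 2 = 1 - 1 / q0 q ^ 2 := by
  have h : ∑ i : Fin 3, q i ^ 2 = ‖q‖ ^ 2 := (EuclideanSpace.real_norm_sq_eq q).symm
  have h0 := (q0_pos q).ne'
  simp_rw [div_pow]
  rw [← Finset.sum_div, h]
  field_simp
  rw [q0_sq]
  ring

/-- Hölder-type lower bound on the proper particle density. -/
theorem nDens_lower_bound (f : E3 → ℝ) (hf : Integrable f) (hf0 : ∀ q, 0 ≤ f q) :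
    ((∫ q, f q) ^ 2 - ∑ i : Fin 3, (∫ q, f q * (q i / q0 q)) ^ 2
        ≥ (∫ q, f q) * ∫ q, f q / (q0 q) ^ 2) ∧
    ((∫ q, f q) * (∫ q, f q / (q0 q) ^ 2) ≥ (∫ q, f q / (q0 q) ^ 2) ^ 2) ∧
    nDens f ≥ ∫ q, f q / (q0 q) ^ 2 := by
  have hv (i : Fin 3) : Continuous fun q : E3 => q i / q0 q :=
    Continuous.div (by fun_prop) continuous_q0 fun q => (q0_pos q).ne'
  have hfv2 (i : Fin 3) : Integrable fun q : E3 => f q * (q i / q0 q) ^ 2 :=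
    integrable_mul_sq hf (hv i).aestronglyMeasurable fun q => abs_div_q0_le_one q i
  have hdiv (q : E3) : f q / q0 q ^ 2 = f q - ∑ i : Fin 3, f q * (q i / q0 q) ^ 2 := by
    rw [← Finset.mul_sum, sum_sq_div_q0]
    ring
  have hint : ∫ q, f q / q0 q ^ 2
      = (∫ q, f q) - ∑ i : Fin 3, ∫ q, f q * (q i / q0 q) ^ 2 := by
    simp_rw [hdiv]
    rw [integral_sub hf (integrable_finsetSum _ fun i _ => hfv2 i),
      integral_finsetSum _ fun i _ => hfv2 i]
  have hF : 0 ≤ ∫ q, f q := integral_nonneg hf0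
  have hG : 0 ≤ ∫ q, f q / q0 q ^ 2 :=
    integral_nonneg fun q => div_nonneg (hf0 q) (sq_nonneg _)
  have hGF : ∫ q, f q / q0 q ^ 2 ≤ ∫ q, f q := by
    rw [hint, sub_le_self_iff]
    exact Finset.sum_nonneg fun i _ =>
      integral_nonneg fun q => mul_nonneg (hf0 q) (sq_nonneg _)
  have h1 : (∫ q, f q) ^ 2 - ∑ i : Fin 3, (∫ q, f q * (q i / q0 q)) ^ 2
      ≥ (∫ q, f q) * ∫ q, f q / (q0 q) ^ 2 := by
    have h := Finset.sum_le_sum fun (i : Fin 3) (_ : i ∈ Finset.univ) =>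
      sq_integral_mul_le hf hf0 (hv i).aestronglyMeasurable fun q => abs_div_q0_le_one q i
    rw [← Finset.mul_sum] at h
    rw [hint, mul_sub]
    linarith
  have h2 : (∫ q, f q) * (∫ q, f q / (q0 q) ^ 2) ≥ (∫ q, f q / (q0 q) ^ 2) ^ 2 := by
    rw [sq]
    exact mul_le_mul_of_nonneg_right hGF hG
  exact ⟨h1, h2, Real.le_sqrt_of_sq_le (h2.trans h1)⟩
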